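/- There is no perfect Slepian-Wolf code for three binary sources of length 5 with 9 total compressed bits; that is, there exist no F₂-matrices H₁, H₂, H₃ with 5 columns and row counts summing to 9 such that the syndrome map is injective on the set S of 3-terminal Hamming sources of length 5. -/

import Mathlib

/-- Hamming weight of a binary vector. -/
def wt {n : ℕ} (v : Fin n → ZMod 2) : ℕ := (Finset.univ.filter fun j => v j ≠ 0).card

/-- The set of `s`-terminal Hamming sources of length `n`. -/
def hammingS (s n : ℕ) : Set (Fin s → Fin n → ZMod 2) :=
  {x | ∃ (b : Fin n → ZMod 2) (v : Fin s → Fin n → ZMod 2),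
    (∀ i, x i = b + v i) ∧ (∑ i, wt (v i)) ≤ 1}

/-- The vector over `𝔽₂` whose coordinates are the bits of `k`. -/
def toVec (k : BitVec 5) : Fin 5 → ZMod 2 := fun j => if k[j] then 1 else 0

/-- At most two bits of `k` are set. -/
def light (k : BitVec 5) : Bool :=
  decide (k[0].toNat + k[1].toNat + k[2].toNat + k[3].toNat + k[4].toNat ≤ 2)

/-- Generators of the two-dimensional binary codes of length 5 and minimum distance 3: pairs of
3-subsets of the coordinates, as bit masks, that meet in exactly one point. -/
def codeGens : List (BitVec 5 × BitVec 5) :=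
  [(7, 25), (11, 21), (19, 13),
   (7, 26), (11, 22), (19, 14),
   (7, 28), (13, 22), (21, 14),
   (11, 28), (13, 26), (25, 14),
   (19, 28), (21, 26), (25, 22)]

/-- The linear span of `g.1` and `g.2`. -/
def span₂ (g : BitVec 5 × BitVec 5) : List (BitVec 5) := [g.1 ^^^ g.2, g.1, g.2, 0]

theorem toVec_xor (k l : BitVec 5) : toVec (k ^^^ l) = toVec k + toVec l := by
  funext j
  simp only [toVec, Pi.add_apply, Fin.getElem_fin, BitVec.getElem_xor]
  cases k[(j : ℕ)] <;> cases l[(j : ℕ)] <;> decide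

theorem toVec_zero : toVec 0 = 0 := by decide

theorem toVec_eq_zero {k : BitVec 5} (h : toVec k = 0) : k = 0 := by
  revert k
  decide +kernel

theorem light_exists {k : BitVec 5} (h : light k) :
    ∃ p q : Fin 5, p ≠ q ∧ ∀ j, j ≠ p → j ≠ q → k[j] = false := by
  revert k
  decide +kernel

theorem exists_mem_codeGens {a b : BitVec 5} (ha : ¬ light a) (hb : ¬ light b)
    (hab : ¬ light (a ^^^ b)) :
    ∃ g ∈ codeGens, (g.1 = a ∨ g.1 = b ∨ g.1 = a ^^^ b) ∧ (g.2 = a ∨ g.2 = b ∨ g.2 = a ^^^ b) := by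
  revert a b
  decide +kernel

theorem exists_light_triple : ∀ g₁ ∈ codeGens, ∀ g₂ ∈ codeGens, ∀ g₃ ∈ codeGens,
    ∃ k ∈ span₂ g₁, ∃ l ∈ span₂ g₂, ∃ m ∈ span₂ g₃,
      light ((k ^^^ l) ||| (k ^^^ m)) ∧ ¬ (k = 0 ∧ l = 0 ∧ m = 0) := by
  decide +kernel

theorem wt_single (p : Fin 5) (c : ZMod 2) : wt (Pi.single p c) = if c = 0 then 0 else 1 := by
  revert p c
  decide

theorem sum_wt_single_le_one (p : Fin 5) (n : Fin 3 → ZMod 2) :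
    ∑ i, wt (Pi.single (M := fun _ : Fin 5 => ZMod 2) p
      (n i - (n 0 * n 1 + n 0 * n 2 + n 1 * n 2))) ≤ 1 := by
  simp only [wt_single]
  revert n
  decide

/-- A triple of vectors that agree off two coordinates is a difference of two Hamming sources. -/
theorem exists_hammingS_sub (n : Fin 3 → Fin 5 → ZMod 2) {p q : Fin 5} (hpq : p ≠ q)
    (h : ∀ j, j ≠ p → j ≠ q → n 0 j = n 1 j ∧ n 0 j = n 2 j) :
    ∃ x ∈ hammingS 3 5, ∃ y ∈ hammingS 3 5, n = x - y := by
  set b : Fin 5 → ZMod 2 := fun j => n 0 j * n 1 j + n 0 j * n 2 j + n 1 j * n 2 j with hb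
  refine ⟨fun i => b + Pi.single p (n i p - b p), ?_,
    fun i => 0 + Pi.single q (n i q - b q), ?_, ?_⟩
  · exact ⟨b, fun i => Pi.single p (n i p - b p), fun _ => rfl,
      sum_wt_single_le_one p fun i => n i p⟩
  · exact ⟨0, fun i => Pi.single q (n i q - b q), fun _ => rfl,
      sum_wt_single_le_one q fun i => n i q⟩
  funext i j
  by_cases hp : j = p
  · subst hp
    simp [hpq]
  by_cases hq : j = q
  · subst hq
    simp [hp, CharTwo.sub_eq_add]
    grind
  obtain ⟨h1, h2⟩ := h j hp hq
  have h3 : ∀ a : ZMod 2, a = a * a + a * a + a * a := by decide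
  have h4 : n i j = n 0 j := by fin_cases i <;> simp [← h1, ← h2]
  simp only [Pi.sub_apply, Pi.add_apply, Pi.single_eq_of_ne hp, Pi.single_eq_of_ne hq, hb, h4,
    ← h1, ← h2, add_zero, Pi.zero_apply, sub_zero]
  exact h3 _

theorem eq_zero_of_light {m₁ m₂ m₃ : ℕ} {H₁ : Matrix (Fin m₁) (Fin 5) (ZMod 2)}
    {H₂ : Matrix (Fin m₂) (Fin 5) (ZMod 2)} {H₃ : Matrix (Fin m₃) (Fin 5) (ZMod 2)}
    (hinj : Set.InjOn
      (fun x : Fin 3 → Fin 5 → ZMod 2 => (H₁.mulVec (x 0), H₂.mulVec (x 1), H₃.mulVec (x 2)))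
      (hammingS 3 5))
    {k l m : BitVec 5} (hk : H₁.mulVec (toVec k) = 0) (hl : H₂.mulVec (toVec l) = 0)
    (hm : H₃.mulVec (toVec m) = 0) (hlight : light ((k ^^^ l) ||| (k ^^^ m))) :
    k = 0 ∧ l = 0 ∧ m = 0 := by
  obtain ⟨p, q, hpq, h⟩ := light_exists hlight
  obtain ⟨x, hx, y, hy, hxy⟩ := exists_hammingS_sub ![toVec k, toVec l, toVec m] hpq (by
    intro j hp hq
    have := h j hp hq
    simp only [Fin.getElem_fin, BitVec.getElem_or, BitVec.getElem_xor, Bool.or_eq_false_iff,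
      bne_eq_false_iff_eq] at this
    simp [toVec, ← this.1, ← this.2])
  have h0 : toVec k = x 0 - y 0 := congrFun hxy 0
  have h1 : toVec l = x 1 - y 1 := congrFun hxy 1
  have h2 : toVec m = x 2 - y 2 := congrFun hxy 2
  rw [h0, Matrix.mulVec_sub, sub_eq_zero] at hk
  rw [h1, Matrix.mulVec_sub, sub_eq_zero] at hl
  rw [h2, Matrix.mulVec_sub, sub_eq_zero] at hm
  have hxy' : x = y := hinj hx hy (by simp only [hk, hl, hm])
  subst hxy'
  rw [sub_self] at h0 h1 h2
  exact ⟨toVec_eq_zero h0, toVec_eq_zero h1, toVec_eq_zero h2⟩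

theorem mulVec_toVec_xor {m : ℕ} {H : Matrix (Fin m) (Fin 5) (ZMod 2)} {k l : BitVec 5}
    (h : H.mulVec (toVec k) = H.mulVec (toVec l)) : H.mulVec (toVec (k ^^^ l)) = 0 := by
  rw [toVec_xor, Matrix.mulVec_add, h]
  exact funext fun i => CharTwo.add_self_eq_zero _

theorem three_le_rows {m : ℕ} {H : Matrix (Fin m) (Fin 5) (ZMod 2)}
    (hH : ∀ k, H.mulVec (toVec k) = 0 → light k → k = 0) : 3 ≤ m := by
  by_contra! hm
  obtain ⟨i, j, hij, h⟩ := Fintype.exists_ne_map_eq_of_card_lt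
    (fun i : Fin 6 => H.mulVec (toVec (![0, 1, 2, 4, 8, 16] i))) (by
      simp only [Fintype.card_pi, ZMod.card, Finset.prod_const, Finset.card_univ, Fintype.card_fin]
      interval_cases m <;> decide)
  have key : ∀ i j : Fin 6, i ≠ j →
      light ((![0, 1, 2, 4, 8, 16] : Fin 6 → BitVec 5) i ^^^ ![0, 1, 2, 4, 8, 16] j) ∧
      (![0, 1, 2, 4, 8, 16] : Fin 6 → BitVec 5) i ^^^ ![0, 1, 2, 4, 8, 16] j ≠ 0 := by
    decide +kernel
  exact (key i j hij).2 (hH _ (mulVec_toVec_xor h) (key i j hij).1)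

theorem exists_codeGens_span {H : Matrix (Fin 3) (Fin 5) (ZMod 2)}
    (hH : ∀ k, H.mulVec (toVec k) = 0 → light k → k = 0) :
    ∃ g ∈ codeGens, ∀ k ∈ span₂ g, H.mulVec (toVec k) = 0 := by
  have hxor : ∀ {k l}, H.mulVec (toVec k) = 0 → H.mulVec (toVec l) = 0 →
      H.mulVec (toVec (k ^^^ l)) = 0 := fun hk hl => mulVec_toVec_xor (hk.trans hl.symm)
  obtain ⟨s, hs⟩ := Fintype.exists_le_card_fiber_of_mul_le_card (n := 4)
    (fun i : Fin 32 => H.mulVec (toVec (BitVec.ofFin i))) (by simp)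
  obtain ⟨a, b, c, ha, hb, hc, hab, hac, hbc⟩ := Finset.two_lt_card_iff.1 (lt_of_lt_of_le (by decide) hs)
  simp only [Finset.mem_filter, Finset.mem_univ, true_and] at ha hb hc
  have hne : ∀ {i j : Fin 32}, i ≠ j → H.mulVec (toVec (BitVec.ofFin i)) = s →
      H.mulVec (toVec (BitVec.ofFin j)) = s → ¬ light (BitVec.ofFin i ^^^ BitVec.ofFin j) := by
    intro i j hij hi hj hlight
    have := hH _ (mulVec_toVec_xor (hi.trans hj.symm)) hlight
    exact hij (congrArg BitVec.toFin (BitVec.xor_eq_zero_iff.1 this))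
  have hab' := mulVec_toVec_xor (ha.trans hb.symm)
  have hbc' := mulVec_toVec_xor (hb.trans hc.symm)
  have hxx : ∀ x y z : BitVec 5, (x ^^^ y) ^^^ (y ^^^ z) = x ^^^ z := fun x y z => by
    rw [BitVec.xor_assoc, ← BitVec.xor_assoc y, BitVec.xor_self, BitVec.zero_xor]
  obtain ⟨g, hg, h1, h2⟩ := exists_mem_codeGens (hne hab ha hb) (hne hbc hb hc)
    (by rw [hxx]; exact hne hac ha hc)
  have hg1 : H.mulVec (toVec g.1) = 0 := by
    rcases h1 with h | h | h <;> rw [h]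
    exacts [hab', hbc', hxor hab' hbc']
  have hg2 : H.mulVec (toVec g.2) = 0 := by
    rcases h2 with h | h | h <;> rw [h]
    exacts [hab', hbc', hxor hab' hbc']
  refine ⟨g, hg, ?_⟩
  simp only [span₂, List.forall_mem_cons]
  exact ⟨hxor hg1 hg2, hg1, hg2, by rw [toVec_zero, Matrix.mulVec_zero], by simp⟩

/-- There is no perfect Slepian-Wolf code for three binary sources of length 5 with 9
total compressed bits: no `F₂`-matrices `H₁, H₂, H₃` with 5 columns and row counts
summing to 9 have a syndrome map injective on the 3-terminal Hamming sources of length 5. -/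
theorem stmt_11 (m₁ m₂ m₃ : ℕ) (hM : m₁ + m₂ + m₃ = 9)
    (H₁ : Matrix (Fin m₁) (Fin 5) (ZMod 2))
    (H₂ : Matrix (Fin m₂) (Fin 5) (ZMod 2))
    (H₃ : Matrix (Fin m₃) (Fin 5) (ZMod 2)) :
    ¬ Set.InjOn
      (fun x : Fin 3 → Fin 5 → ZMod 2 => (H₁.mulVec (x 0), H₂.mulVec (x 1), H₃.mulVec (x 2)))
      (hammingS 3 5) := by
  intro hinj
  have hz : ∀ {m : ℕ} (H : Matrix (Fin m) (Fin 5) (ZMod 2)), H.mulVec (toVec 0) = 0 :=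
    fun H => by rw [toVec_zero, Matrix.mulVec_zero]
  have h₁ : ∀ k, H₁.mulVec (toVec k) = 0 → light k → k = 0 := fun k hk hlight =>
    (eq_zero_of_light hinj hk (hz H₂) (hz H₃) (by simpa using hlight)).1
  have h₂ : ∀ k, H₂.mulVec (toVec k) = 0 → light k → k = 0 := fun k hk hlight =>
    (eq_zero_of_light hinj (hz H₁) hk (hz H₃) (by simpa using hlight)).2.1
  have h₃ : ∀ k, H₃.mulVec (toVec k) = 0 → light k → k = 0 := fun k hk hlight =>
    (eq_zero_of_light hinj (hz H₁) (hz H₂) hk (by simpa using hlight)).2.2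
  have := three_le_rows h₁
  have := three_le_rows h₂
  have := three_le_rows h₃
  obtain ⟨rfl, rfl, rfl⟩ : m₁ = 3 ∧ m₂ = 3 ∧ m₃ = 3 := by omega
  obtain ⟨g₁, hg₁, hk₁⟩ := exists_codeGens_span h₁
  obtain ⟨g₂, hg₂, hk₂⟩ := exists_codeGens_span h₂
  obtain ⟨g₃, hg₃, hk₃⟩ := exists_codeGens_span h₃
  obtain ⟨k, hk, l, hl, m, hm, hlight, hne⟩ := exists_light_triple g₁ hg₁ g₂ hg₂ g₃ hg₃
  exact hne (eq_zero_of_light hinj (hk₁ k hk) (hk₂ l hl) (hk₃ m hm) hlight)
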